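/- Let n ≥ 10 be an even integer and let d be a positive integer with d < n - 2. Then every group homomorphism from the alternating group A_n to the general linear group GL_d(𝔽₂) of invertible d × d matrices over the field 𝔽₂ with two elements is trivial. -/

import Mathlib

open Equiv Module

/-- The even permutation `a ↦ b ↦ c ↦ a`, written as a square so that it is even for all
`a b c`, distinct or not. -/
def cyc {α : Type*} [Fintype α] [DecidableEq α] (a b c : α) : alternatingGroup α :=
  ⟨(swap a c * swap c b) ^ 2, by
    rw [Perm.mem_alternatingGroup, map_pow]; exact Int.units_sq _⟩

section Cyc

variable {α : Type*} [Fintype α] [DecidableEq α]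

theorem coe_cyc (a b c : α) : (cyc a b c : Perm α) = (swap a c * swap c b) ^ 2 := rfl

theorem conj_cyc (g : Perm α) (a b c : α) :
    g * (cyc a b c : Perm α) * g⁻¹ = cyc (g a) (g b) (g c) := by
  simp only [coe_cyc, swap_apply_apply, pow_two]
  group

theorem alternating_conj_cyc (g : alternatingGroup α) (a b c : α) :
    g * cyc a b c * g⁻¹ = cyc (g.1 a) (g.1 b) (g.1 c) :=
  Subtype.ext (conj_cyc g.1 a b c)

variable {a b c : α}

theorem cyc_apply (hab : a ≠ b) (hac : a ≠ c) (hbc : b ≠ c) (x : α) :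
    (cyc a b c : Perm α) x = if x = a then b else if x = b then c else if x = c then a else x := by
  simp only [coe_cyc, pow_two, Perm.mul_apply, swap_apply_def]
  grind

theorem coe_cyc_eq (hab : a ≠ b) (hac : a ≠ c) (hbc : b ≠ c) :
    (cyc a b c : Perm α) = swap a b * swap b c := by
  ext x
  simp only [cyc_apply hab hac hbc, Perm.mul_apply, swap_apply_def]
  grind

theorem cyc_rotate (hab : a ≠ b) (hac : a ≠ c) (hbc : b ≠ c) : cyc b c a = cyc a b c := by
  ext x
  simp only [cyc_apply hab hac hbc, cyc_apply hbc hab.symm hac.symm]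
  grind

theorem cyc_pow_three (hab : a ≠ b) (hac : a ≠ c) (hbc : b ≠ c) : cyc a b c ^ 3 = 1 := by
  ext x
  simp only [pow_succ, pow_zero, one_mul, Subgroup.coe_mul, Perm.mul_apply,
    cyc_apply hab hac hbc, Subgroup.coe_one, Perm.one_apply]
  grind

theorem cyc_swap_mul (hab : a ≠ b) (hac : a ≠ c) (hbc : b ≠ c) :
    cyc b a c * cyc a b c = 1 := by
  ext x
  simp only [Subgroup.coe_mul, Perm.mul_apply,
    cyc_apply hab hac hbc, cyc_apply hab.symm hbc hac, Subgroup.coe_one, Perm.one_apply]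
  grind

theorem cyc_inv (hab : a ≠ b) (hac : a ≠ c) (hbc : b ≠ c) : (cyc a b c)⁻¹ = cyc b a c :=
  (eq_inv_of_mul_eq_one_left (cyc_swap_mul hab hac hbc)).symm

theorem isThreeCycle_cyc (hab : a ≠ b) (hac : a ≠ c) (hbc : b ≠ c) :
    (cyc a b c : Perm α).IsThreeCycle := by
  rw [coe_cyc_eq hab hac hbc, swap_comm]
  exact Perm.isThreeCycle_swap_mul_swap_same hab.symm hbc hac

theorem commute_cyc {d e f : α} (h : [a, b, c, d, e, f].Nodup) :
    Commute (cyc a b c) (cyc d e f) := by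
  simp only [List.nodup_cons, List.mem_cons] at h
  have h1 := alternating_conj_cyc (cyc a b c) d e f
  have h2 : ∀ x, x ≠ a → x ≠ b → x ≠ c → (cyc a b c : Perm α) x = x := fun x _ _ _ ↦ by
    rw [cyc_apply] <;> grind
  rw [h2 d, h2 e, h2 f] at h1
  · exact mul_inv_eq_iff_eq_mul.mp h1
  all_goals grind

end Cyc

section Blocks

/-- The permutation exchanging two blocks pointwise. -/
def swapBlocks {α : Type*} [DecidableEq α] {k : ℕ} (e : Fin k × Fin 3 ↪ α)
    (i j : Fin k) : Perm α :=
  swap (e (i, 0)) (e (j, 0)) * swap (e (i, 1)) (e (j, 1)) * swap (e (i, 2)) (e (j, 2))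

theorem swapBlocks_apply {α : Type*} [DecidableEq α] {k : ℕ} (e : Fin k × Fin 3 ↪ α)
    (i j l : Fin k) (r : Fin 3) :
    swapBlocks e i j (e (l, r)) = e (swap i j l, r) := by
  simp only [swapBlocks, Perm.mul_apply, swap_apply_def]
  fin_cases r <;> grind [e.injective.eq_iff]

variable {α : Type*} [Fintype α] [DecidableEq α] {k : ℕ}

/-- The 3-cycle supported on the `i`-th of a family of disjoint blocks of three points. -/
def blockCycle (e : Fin k × Fin 3 ↪ α) (i : Fin k) : alternatingGroup α :=
  cyc (e (i, 0)) (e (i, 1)) (e (i, 2))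

/-- The even or odd permutation `h` normalises the group generated by the block cycles and carries
the character `χ` of that group to `χ'`. -/
def Transports {K : Type*} [Field K] (e : Fin k × Fin 3 ↪ α) (h : Perm α) (χ χ' : Fin k → K) :
    Prop :=
  ∀ i, ∃ j, (h * blockCycle e j * h⁻¹ = (blockCycle e i : Perm α) ∧ χ' i = χ j) ∨
    (h * blockCycle e j * h⁻¹ = (blockCycle e i : Perm α)⁻¹ ∧ χ' i = (χ j)⁻¹)

/-- The character `χ` of the group generated by the block cycles occurs in `ρ`. -/
def Occurs {K V : Type*} [Field K] [AddCommGroup V] [Module K V]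
    (ρ : alternatingGroup α →* End K V) (e : Fin k × Fin 3 ↪ α) (χ : Fin k → K) : Prop :=
  ∃ v ≠ 0, ∀ i, ρ (blockCycle e i) v = χ i • v

theorem blockCycle_pow_three (e : Fin k × Fin 3 ↪ α) (i : Fin k) : blockCycle e i ^ 3 = 1 :=
  cyc_pow_three (by simp) (by simp) (by simp)

theorem commute_blockCycle (e : Fin k × Fin 3 ↪ α) {i j : Fin k} (hij : i ≠ j) :
    Commute (blockCycle e i) (blockCycle e j) :=
  commute_cyc (by simp [hij])

theorem blockCycle_inv (e : Fin k × Fin 3 ↪ α) (i : Fin k) :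
    (blockCycle e i)⁻¹ = cyc (e (i, 1)) (e (i, 0)) (e (i, 2)) :=
  cyc_inv (by simp) (by simp) (by simp)

variable {K V : Type*} [Field K] [AddCommGroup V] [Module K V]
  {ρ : alternatingGroup α →* End K V} {e : Fin k × Fin 3 ↪ α} {χ χ' χ'' : Fin k → K}

theorem Transports.mul {g h : Perm α} (hg : Transports e g χ' χ'') (hh : Transports e h χ χ') :
    Transports e (g * h) χ χ'' := by
  intro i
  obtain ⟨j, hj⟩ := hg i
  obtain ⟨l, hl⟩ := hh j
  refine ⟨l, ?_⟩
  have key : g * h * (blockCycle e l : Perm α) * (g * h)⁻¹ =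
    g * (h * (blockCycle e l : Perm α) * h⁻¹) * g⁻¹ := by group
  have key' : g * (blockCycle e j : Perm α)⁻¹ * g⁻¹ =
    (g * (blockCycle e j : Perm α) * g⁻¹)⁻¹ := by group
  rw [key]
  rcases hj with ⟨h1, h2⟩ | ⟨h1, h2⟩ <;> rcases hl with ⟨h3, h4⟩ | ⟨h3, h4⟩ <;>
    simp [h1, h2, h3, h4, key']

theorem Occurs.pow_three (h : Occurs ρ e χ) (i : Fin k) : χ i ^ 3 = 1 := by
  obtain ⟨v, hv, hχ⟩ := h
  have h3 : (ρ (blockCycle e i) ^ 3) v = v := by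
    rw [← map_pow, blockCycle_pow_three, map_one, End.one_apply]
  simp only [pow_succ, pow_zero, one_mul, End.mul_apply, hχ, map_smul, smul_smul] at h3
  have : (χ i ^ 3 - 1) • v = 0 := by
    rw [sub_smul, one_smul, sub_eq_zero]; convert h3 using 2; ring
  exact sub_eq_zero.mp ((smul_eq_zero.mp this).resolve_right hv)

theorem Occurs.transport_even (h : Occurs ρ e χ) (g : alternatingGroup α)
    (hg : Transports e (g : Perm α) χ χ') : Occurs ρ e χ' := by
  have h3 := h.pow_three
  obtain ⟨v, hv, hχ⟩ := h
  have hmul : ∀ a b : alternatingGroup α, ∀ w, ρ (a * b) w = ρ a (ρ b w) := fun a b w ↦ by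
    rw [map_mul, End.mul_apply]
  refine ⟨ρ g v, fun h0 ↦ hv ?_, fun i ↦ ?_⟩
  · have := hmul g⁻¹ g v
    rwa [h0, map_zero, inv_mul_cancel, map_one, End.one_apply] at this
  obtain ⟨j, ⟨h1, h2⟩ | ⟨h1, h2⟩⟩ := hg i
  · have h1' : g * blockCycle e j * g⁻¹ = blockCycle e i := Subtype.ext h1
    rw [← h1', h2, ← hmul, inv_mul_cancel_right, hmul, hχ, map_smul]
  · have h1' : g * blockCycle e j * g⁻¹ = (blockCycle e i)⁻¹ := Subtype.ext h1
    have h1'' : blockCycle e i * g * blockCycle e j = g := by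
      rw [← inv_inv (blockCycle e i), ← h1']; group
    have hne : χ j ≠ 0 := fun h0 ↦ by simpa [h0] using h3 j
    have := hmul (blockCycle e i * g) (blockCycle e j) v
    rw [h1'', hχ, map_smul, hmul] at this
    rw [h2, eq_inv_smul_iff₀ hne, this.symm]

theorem sign_swapBlocks {i j : Fin k} (hij : i ≠ j) : Perm.sign (swapBlocks e i j) = -1 := by
  simp [swapBlocks, hij]

theorem transports_swapBlocks (e : Fin k × Fin 3 ↪ α) (χ : Fin k → K) (i j : Fin k) :
    Transports e (swapBlocks e i j) χ (χ ∘ swap i j) := fun l ↦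
  ⟨swap i j l, .inl ⟨by simp [blockCycle, conj_cyc, swapBlocks_apply], rfl⟩⟩

theorem transports_swap (e : Fin k × Fin 3 ↪ α) (χ : Fin k → K) (i : Fin k) :
    Transports e (swap (e (i, 0)) (e (i, 1))) χ (Function.update χ i (χ i)⁻¹) := by
  intro l
  refine ⟨l, ?_⟩
  rcases eq_or_ne l i with rfl | hl
  · right
    rw [← Subgroup.coe_inv, blockCycle_inv, blockCycle, conj_cyc]
    simp [swap_apply_of_ne_of_ne]
  · left
    rw [blockCycle, conj_cyc]
    simp [swap_apply_of_ne_of_ne, hl]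

theorem Occurs.exists_odd_transports (h : Occurs ρ e χ) (hk : 3 ≤ k) :
    ∃ g, Perm.sign g = -1 ∧ Transports e g χ χ := by
  have h3 := h.pow_three
  by_cases hi : ∃ i, χ i = 1
  · obtain ⟨i, hi⟩ := hi
    refine ⟨swap (e (i, 0)) (e (i, 1)), by simp, ?_⟩
    convert transports_swap e χ i
    rw [hi, inv_one, ← hi, Function.update_eq_self]
  push Not at hi
  have hij : ∃ i j, i ≠ j ∧ χ i = χ j := by
    by_contra! hc
    have hq : ∀ i, χ i ^ 2 + χ i + 1 = 0 := fun i ↦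
      (mul_eq_zero.mp (show (χ i - 1) * (χ i ^ 2 + χ i + 1) = 0 by
        linear_combination h3 i)).resolve_left (sub_ne_zero.mpr (hi i))
    have hs : ∀ i j, i ≠ j → χ i + χ j + 1 = 0 := fun i j hij ↦
      (mul_eq_zero.mp (show (χ i - χ j) * (χ i + χ j + 1) = 0 by
        linear_combination hq i - hq j)).resolve_left (sub_ne_zero.mpr (hc i j hij))
    have h01 := hs ⟨0, by omega⟩ ⟨1, by omega⟩ (by simp)
    have h02 := hs ⟨0, by omega⟩ ⟨2, by omega⟩ (by simp)
    exact hc ⟨1, by omega⟩ ⟨2, by omega⟩ (by simp) (by linear_combination h01 - h02)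
  obtain ⟨i, j, hij, hχ⟩ := hij
  refine ⟨swapBlocks e i j, sign_swapBlocks hij, ?_⟩
  convert transports_swapBlocks e χ i j
  ext l
  simp only [Function.comp_apply, swap_apply_def]
  grind

theorem Occurs.transport (h : Occurs ρ e χ) (hk : 3 ≤ k) {g : Perm α}
    (hg : Transports e g χ χ') : Occurs ρ e χ' := by
  rcases Int.units_eq_one_or (Perm.sign g) with hs | hs
  · exact h.transport_even ⟨g, hs⟩ hg
  · obtain ⟨g', hs', hg'⟩ := h.exists_odd_transports hk
    exact h.transport_even ⟨g * g', by simp [Perm.mem_alternatingGroup, hs, hs']⟩ (hg.mul hg')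

theorem Occurs.comp_perm (h : Occurs ρ e χ) (hk : 3 ≤ k) (σ : Perm (Fin k)) :
    Occurs ρ e (χ ∘ σ) := by
  induction σ using Perm.swap_induction_on' with
  | one => exact h
  | mul_swap σ i j _ ih => exact ih.transport hk (transports_swapBlocks e _ i j)

theorem Occurs.piecewise_inv (h : Occurs ρ e χ) (hk : 3 ≤ k) (s : Finset (Fin k)) :
    Occurs ρ e (s.piecewise χ⁻¹ χ) := by
  induction s using Finset.induction_on with
  | empty => simpa using h
  | insert i s hi ih =>
    convert ih.transport hk (transports_swap e _ i) using 1
    rw [Finset.piecewise_insert]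
    simp [hi]

theorem Occurs.of_card_eq (h : Occurs ρ e χ) (hk : 3 ≤ k) (h3 : ∀ i, χ' i ^ 3 = 1)
    (hc : Nat.card {i // χ' i ≠ 1} = Nat.card {i // χ i ≠ 1}) : Occurs ρ e χ' := by
  classical
  let ε : {i // χ' i ≠ 1} ≃ {i // χ i ≠ 1} :=
    Fintype.equivOfCardEq (by simpa [Nat.card_eq_fintype_card] using hc)
  have hσ := h.comp_perm hk ε.extendSubtype
  have hsupp : ∀ i, χ (ε.extendSubtype i) ≠ 1 ↔ χ' i ≠ 1 := fun i ↦
    ⟨fun h1 ↦ by_contra fun h2 ↦ ε.extendSubtype_not_mem i h2 h1, ε.extendSubtype_mem i⟩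
  convert hσ.piecewise_inv hk {i | χ' i ≠ χ (ε.extendSubtype i)} using 1
  ext i
  simp only [Finset.piecewise, Finset.mem_filter, Finset.mem_univ, true_and]
  split_ifs with hi
  · have hx := h3 i
    have hy := hσ.pow_three i
    simp only [Function.comp_apply, Pi.inv_apply] at hy ⊢
    have hx1 : χ' i ≠ 1 := fun h1 ↦ hi (by rw [h1]; by_contra h2; exact (hsupp i).mp (Ne.symm h2) h1)
    have hy1 := (hsupp i).mpr hx1
    generalize χ (ε.extendSubtype i) = y at *
    generalize χ' i = x at *
    have h1 : x ^ 2 + x + 1 = 0 :=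
      (mul_eq_zero.mp (show (x - 1) * (x ^ 2 + x + 1) = 0 by
        linear_combination hx)).resolve_left (sub_ne_zero.mpr hx1)
    have h2 : y ^ 2 + y + 1 = 0 :=
      (mul_eq_zero.mp (show (y - 1) * (y ^ 2 + y + 1) = 0 by
        linear_combination hy)).resolve_left (sub_ne_zero.mpr hy1)
    have h4 : x + y + 1 = 0 :=
      (mul_eq_zero.mp (show (x - y) * (x + y + 1) = 0 by
        linear_combination h1 - h2)).resolve_left (sub_ne_zero.mpr hi)
    exact eq_inv_of_mul_eq_one_left (by linear_combination y * h4 - h2)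
  · simpa using hi

end Blocks

section Counting

variable {α : Type*} [Fintype α] [DecidableEq α] {k : ℕ}
  {K V : Type*} [Field K] [AddCommGroup V] [Module K V]
  {ρ : alternatingGroup α →* End K V} {e : Fin k × Fin 3 ↪ α} {χ χ' : Fin k → K}

theorem card_le_finrank_of_occurs [FiniteDimensional K V] (s : Finset (Fin k → K))
    (hs : ∀ χ ∈ s, Occurs ρ e χ) : s.card ≤ finrank K V := by
  choose! v hv0 hv using hs
  have hind := (End.independent_iInf_maxGenEigenspace_of_forall_mapsTo
    (fun i ↦ ρ (blockCycle e i)) fun i j φ ↦ End.mapsTo_maxGenEigenspace_of_comm (by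
      rcases eq_or_ne j i with rfl | h
      · exact .refl _
      · exact (commute_blockCycle e h).map ρ) φ).comp (f := ((↑) : s → Fin k → K))
    Subtype.val_injective
  have hlin := hind.linearIndependent (v := fun χ : s ↦ v χ) _
    (fun χ ↦ by
      simp only [Function.comp_apply, Submodule.mem_iInf]
      intro i
      have h : v χ ∈ (ρ (blockCycle e i)).eigenspace (χ.1 i) :=
        End.mem_eigenspace_iff.mpr (hv χ χ.2 i)
      exact (End.genEigenspace _ _).mono le_top h)
    (fun χ ↦ hv0 χ χ.2)
  simpa using hlin.fintype_card_le_finrank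

theorem Occurs.choose_mul_two_pow_le [FiniteDimensional K V] (h : Occurs ρ e χ) (hk : 3 ≤ k)
    {ω : K} (hω : ω ^ 3 = 1) (hω1 : ω ≠ 1) :
    k.choose (Nat.card {i // χ i ≠ 1}) * 2 ^ Nat.card {i // χ i ≠ 1} ≤ finrank K V := by
  classical
  set w := Nat.card {i // χ i ≠ 1} with hw
  have hω2 : ω ^ 2 ≠ 1 := fun h2 ↦ hω1 (by linear_combination hω - ω * h2)
  have hωω : ω ≠ ω ^ 2 := fun h2 ↦ hω2 (by linear_combination hω + ω * h2)
  let T : Finset (Fin k) → Finset (Fin k → K) := fun s ↦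
    Fintype.piFinset fun i ↦ if i ∈ s then {ω, ω ^ 2} else {1}
  have hT : ∀ s, ∀ f ∈ T s, ∀ i, f i ≠ 1 ↔ i ∈ s := by
    intro s f hf i
    have := Fintype.mem_piFinset.mp hf i
    split_ifs at this with hi
    · simp only [Finset.mem_insert, Finset.mem_singleton] at this
      rcases this with h | h <;> simp [h, hi, hω1, hω2]
    · simpa [hi] using this
  have hcard : ∀ s, (T s).card = 2 ^ s.card := by
    intro s
    have : ∀ i, (if i ∈ s then ({ω, ω ^ 2} : Finset K) else {1}).card = if i ∈ s then 2 else 1 :=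
      fun i ↦ by split_ifs <;> simp [hωω]
    simp [T, Fintype.card_piFinset, this]
  let S := (Finset.powersetCard w Finset.univ).biUnion T
  have hS : S.card = k.choose w * 2 ^ w := by
    rw [Finset.card_biUnion]
    · rw [Finset.sum_congr rfl fun s hs ↦ by
        rw [hcard, (Finset.mem_powersetCard.mp hs).2]]
      simp
    · intro s _ t _ hst
      refine Finset.disjoint_left.mpr fun f hf hf' ↦ hst ?_
      ext i
      rw [← hT s f hf, ← hT t f hf']
  rw [← hS]
  refine card_le_finrank_of_occurs (ρ := ρ) (e := e) S fun f hf ↦ ?_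
  obtain ⟨s, hs, hf⟩ := Finset.mem_biUnion.mp hf
  refine h.of_card_eq hk (fun i ↦ ?_) ?_
  · have := Fintype.mem_piFinset.mp hf i
    split_ifs at this with hi
    · simp only [Finset.mem_insert, Finset.mem_singleton] at this
      rcases this with h | h
      · rw [h, hω]
      · rw [h, ← pow_mul, mul_comm, pow_mul, hω, one_pow]
    · rw [Finset.mem_singleton.mp this, one_pow]
  · simp_rw [hT s f hf]
    rw [← hw, ← (Finset.mem_powersetCard.mp hs).2]
    simp

theorem three_mul_le_choose_mul_two_pow {k w : ℕ} (hk : 4 ≤ k) (hw : 2 ≤ w) (hwk : w ≤ k) :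
    3 * k ≤ k.choose w * 2 ^ w := by
  induction k, hk using Nat.le_induction generalizing w with
  | base => interval_cases w <;> decide
  | succ k hk ih =>
    obtain rfl | h := hwk.eq_or_lt
    · have := ih (w := k) (by omega) le_rfl
      simp only [Nat.choose_self, pow_succ] at this ⊢
      omega
    · have h1 := ih hw (by omega)
      obtain ⟨w, rfl⟩ : ∃ v, w = v + 1 := ⟨w - 1, by omega⟩
      have h2 : 1 ≤ k.choose w := Nat.choose_pos (by omega)
      have h3 : 2 ^ 2 ≤ 2 ^ (w + 1) := Nat.pow_le_pow_right (by norm_num) hw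
      rw [Nat.choose_succ_succ, add_mul]
      nlinarith

theorem sub_two_le_choose_mul_two_pow {n w : ℕ} (hn : Even n) (h10 : 10 ≤ n) (hw : 2 ≤ w)
    (hwk : w ≤ n / 3) : n - 2 ≤ (n / 3).choose w * 2 ^ w := by
  by_cases h : 4 ≤ n / 3
  · have := three_mul_le_choose_mul_two_pow h hw hwk
    omega
  · obtain ⟨m, rfl⟩ := hn
    obtain rfl : m = 5 := by omega
    have : w = 2 ∨ w = 3 := by omega
    rcases this with rfl | rfl <;> decide

theorem iSup_iInf_eigenspace_blockCycle [IsAlgClosed K] [FiniteDimensional K V]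
    (h3 : (3 : K) ≠ 0) (ρ : alternatingGroup α →* End K V) (e : Fin k × Fin 3 ↪ α) :
    ⨆ χ : Fin k → K, ⨅ i, (ρ (blockCycle e i)).eigenspace (χ i) = ⊤ := by
  have hss : ∀ i, (ρ (blockCycle e i)).IsSemisimple := fun i ↦ by
    refine End.isSemisimple_of_squarefree_aeval_eq_zero
      (p := (Polynomial.X ^ 3 - 1 : Polynomial K)) ?_ ?_
    · exact (Polynomial.separable_X_pow_sub_C (1 : K) (by exact_mod_cast h3) one_ne_zero).squarefree
    · rw [map_sub, map_pow, Polynomial.aeval_X, map_one, ← map_pow, blockCycle_pow_three, map_one,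
        sub_self]
  simp_rw [← (hss _).isFinitelySemisimple.maxGenEigenspace_eq_eigenspace]
  exact End.iSup_iInf_maxGenEigenspace_eq_top_of_iSup_maxGenEigenspace_eq_top_of_commute _
    (fun i j hij ↦ (commute_blockCycle e hij).map ρ)
    fun i ↦ End.iSup_maxGenEigenspace_eq_top _

theorem sub_one_mul_sub_one_eq_zero [IsAlgClosed K] [FiniteDimensional K V]
    (h3 : (3 : K) ≠ 0) {n : ℕ} (hn : Even n) (h10 : 10 ≤ n) (hd : finrank K V < n - 2)
    (ρ : alternatingGroup α →* End K V) (e : Fin (n / 3) × Fin 3 ↪ α) {i j : Fin (n / 3)}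
    (hij : i ≠ j) :
    (ρ (blockCycle e i) - 1) * (ρ (blockCycle e j) - 1) = 0 := by
  obtain ⟨ω, hω⟩ := IsAlgClosed.exists_root (Polynomial.X ^ 2 + Polynomial.X + 1 : Polynomial K)
    (by rw [show (Polynomial.X ^ 2 + Polynomial.X + 1 : Polynomial K).degree = 2 by compute_degree!]
        norm_num)
  simp only [Polynomial.IsRoot, Polynomial.eval_add, Polynomial.eval_pow, Polynomial.eval_X,
    Polynomial.eval_one] at hω
  have hω3 : ω ^ 3 = 1 := by linear_combination (ω - 1) * hω
  have hω1 : ω ≠ 1 := fun h ↦ h3 (by rw [h] at hω; linear_combination hω)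
  rw [← LinearMap.ker_eq_top, eq_top_iff, ← iSup_iInf_eigenspace_blockCycle h3 ρ e, iSup_le_iff]
  intro χ v hv
  simp only [Submodule.mem_iInf, End.mem_eigenspace_iff] at hv
  by_contra hne
  have hval : ((ρ (blockCycle e i) - 1) * (ρ (blockCycle e j) - 1)) v =
      ((χ j - 1) * (χ i - 1)) • v := by
    simp only [End.mul_apply, LinearMap.sub_apply, End.one_apply, hv, map_sub, map_smul]
    module
  rw [LinearMap.mem_ker, hval, smul_eq_zero, not_or, mul_eq_zero, not_or, sub_eq_zero,
    sub_eq_zero] at hne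
  have hocc : Occurs ρ e χ := ⟨v, hne.2, hv⟩
  have hle := hocc.choose_mul_two_pow_le (by omega) hω3 hω1
  have h2 : 2 ≤ Nat.card {i // χ i ≠ 1} := by
    exact (Finite.one_lt_card_iff_nontrivial).mpr
      ⟨⟨i, hne.1.2⟩, ⟨j, hne.1.1⟩, by simpa using hij⟩
  have hk : Nat.card {i // χ i ≠ 1} ≤ n / 3 := by
    simpa using Nat.card_le_card_of_injective (Subtype.val : {i // χ i ≠ 1} → _)
      Subtype.val_injective
  have := sub_two_le_choose_mul_two_pow hn h10 h2 hk
  omega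

end Counting

section Descent

/-- The representation over `K` given by a matrix representation over a subring of scalars. -/
def matrixRep {G k : Type*} [Group G] [CommRing k] {d : ℕ} (K : Type*) [CommRing K] [Algebra k K]
    (f : G →* GL (Fin d) k) : G →* End K (Fin d → K) :=
  (Matrix.toLinAlgEquiv' (R := K) (n := Fin d)).toRingEquiv.toMonoidHom.comp
    (((algebraMap k K).mapMatrix (m := Fin d)).toMonoidHom.comp ((Units.coeHom _).comp f))

theorem matrixRep_apply {G k : Type*} [Group G] [CommRing k] {d : ℕ} (K : Type*) [CommRing K]
    [Algebra k K] (f : G →* GL (Fin d) k) (g : G) :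
    matrixRep K f g = Matrix.toLinAlgEquiv' ((algebraMap k K).mapMatrix (f g : Matrix _ _ k)) :=
  rfl

theorem matrixRep_self_sub_one_mul_sub_one {n d : ℕ} (hn : Even n) (h10 : 10 ≤ n) (hd : d < n - 2)
    (f : alternatingGroup (Fin n) →* GL (Fin d) (ZMod 2)) (e : Fin (n / 3) × Fin 3 ↪ Fin n)
    {i j : Fin (n / 3)} (hij : i ≠ j) :
    (matrixRep (ZMod 2) f (blockCycle e i) - 1) * (matrixRep (ZMod 2) f (blockCycle e j) - 1)
      = 0 := by
  have : CharP (AlgebraicClosure (ZMod 2)) 2 := charP_of_injective_algebraMap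
    (algebraMap (ZMod 2) (AlgebraicClosure (ZMod 2))).injective 2
  have h3 : (3 : AlgebraicClosure (ZMod 2)) ≠ 0 := by
    have h2 : (2 : AlgebraicClosure (ZMod 2)) = 0 := CharTwo.two_eq_zero
    intro h
    exact one_ne_zero (α := AlgebraicClosure (ZMod 2)) (by linear_combination h - h2)
  have h := sub_one_mul_sub_one_eq_zero h3 hn h10 (by simpa using hd)
    (matrixRep (AlgebraicClosure (ZMod 2)) f) e hij
  have hinj : Function.Injective ((algebraMap (ZMod 2) (AlgebraicClosure (ZMod 2))).mapMatrix
      (m := Fin d)) := 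
    Matrix.map_injective (algebraMap (ZMod 2) (AlgebraicClosure (ZMod 2))).injective
  simp only [matrixRep_apply] at h ⊢
  rw [← map_one Matrix.toLinAlgEquiv', ← map_sub, ← map_sub, ← map_mul,
    map_eq_zero_iff _ Matrix.toLinAlgEquiv'.injective] at h ⊢
  rw [← map_one (algebraMap (ZMod 2) (AlgebraicClosure (ZMod 2))).mapMatrix, ← map_sub, ← map_sub,
    ← map_mul, map_eq_zero_iff _ hinj] at h
  simpa using h

/-- Every six distinct points form the first two of a maximal family of disjoint blocks. -/
theorem exists_blocks {n : ℕ} (h9 : 9 ≤ n) {a b c d e f : Fin n} (h : [a, b, c, d, e, f].Nodup) :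
    ∃ (ε : Fin (n / 3) × Fin 3 ↪ Fin n) (i j : Fin (n / 3)), i ≠ j ∧
      blockCycle ε i = cyc a b c ∧ blockCycle ε j = cyc d e f := by
  let x : Fin 6 ↪ Fin n := Fin.castLEEmb (by omega)
  let y : Fin 6 ↪ Fin n := ⟨[a, b, c, d, e, f].get, List.nodup_iff_injective_get.mp h⟩
  obtain ⟨σ, hσ⟩ := ((Equiv.Perm.isMultiplyPretransitive (Fin n) 6).exists_smul_eq x y)
  have hσ' : ∀ r : Fin 6, σ (x r) = y r := fun r ↦ DFunLike.congr_fun hσ r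
  let φ : Fin (n / 3) × Fin 3 ↪ Fin n :=
    ⟨fun p ↦ ⟨3 * p.1 + p.2, by have := p.1.2; have := p.2.2; omega⟩, fun p q hpq ↦ by
      simp only [Fin.mk.injEq] at hpq
      ext <;> omega⟩
  refine ⟨φ.trans σ.toEmbedding, ⟨0, by omega⟩, ⟨1, by omega⟩, by simp, ?_, ?_⟩
  · exact congr (congrArg₂ cyc (hσ' 0) (hσ' 1)) (hσ' 2)
  · exact congr (congrArg₂ cyc (hσ' 3) (hσ' 4)) (hσ' 5)

end Descent

section Moved

variable {F V α : Type*} [Field F] [AddCommGroup V] [Module F V] [Fintype α] [DecidableEq α]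

/-- The commutator space `[V, t]` of the 3-cycle `t = (a b c)`. -/
def moved (ρ : alternatingGroup α →* End F V) (a b c : α) : Submodule F V :=
  LinearMap.range (ρ (cyc a b c) - 1)

variable (ρ : alternatingGroup α →* End F V) {a b c d : α}

theorem sub_mem_moved (v : V) : ρ (cyc a b c) v - v ∈ moved ρ a b c := ⟨v, rfl⟩

theorem map_moved (g : alternatingGroup α) (a b c : α) :
    (moved ρ a b c).map (ρ g) = moved ρ (g.1 a) (g.1 b) (g.1 c) := by
  have hg : LinearMap.range (ρ g⁻¹) = ⊤ := LinearMap.range_eq_top.mpr fun v ↦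
    ⟨ρ g v, by rw [← End.mul_apply, ← map_mul, inv_mul_cancel, map_one, End.one_apply]⟩
  have h : ρ (cyc (g.1 a) (g.1 b) (g.1 c)) - 1 = (ρ g * (ρ (cyc a b c) - 1)) * ρ g⁻¹ := by
    rw [← alternating_conj_cyc, mul_sub, sub_mul, mul_one, ← map_mul, ← map_mul, ← map_mul,
      mul_inv_cancel, map_one]
  rw [moved, moved, h, End.mul_eq_comp (_ * _), LinearMap.range_comp, hg, End.mul_eq_comp,
    Submodule.map_top, LinearMap.range_comp]

theorem apply_mem_moved {v : V} (hv : v ∈ moved ρ a b c) (g : alternatingGroup α) :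
    ρ g v ∈ moved ρ (g.1 a) (g.1 b) (g.1 c) :=
  map_moved ρ g a b c ▸ Submodule.mem_map_of_mem hv

theorem rep_injective (g : alternatingGroup α) : Function.Injective (ρ g) :=
  Function.LeftInverse.injective (g := ρ g⁻¹) fun v ↦ by
    rw [← End.mul_apply, ← map_mul, inv_mul_cancel, map_one, End.one_apply]

theorem moved_rotate (h : [a, b, c].Nodup) : moved ρ b c a = moved ρ a b c := by
  simp only [List.nodup_cons, List.mem_cons] at h
  rw [moved, cyc_rotate (by grind) (by grind) (by grind), moved]

theorem moved_flip (h : [a, b, c].Nodup) : moved ρ b a c = moved ρ a b c := by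
  simp only [List.nodup_cons, List.mem_cons] at h
  have hs := cyc_swap_mul (a := a) (b := b) (c := c) (by grind) (by grind) (by grind)
  have hs' := cyc_swap_mul (a := b) (b := a) (c := c) (by grind) (by grind) (by grind)
  have key : ∀ x y : alternatingGroup α, x * y = 1 →
      LinearMap.range (ρ x - 1) ≤ LinearMap.range (ρ y - 1) := by
    rintro x y h _ ⟨v, rfl⟩
    refine ⟨-ρ x v, ?_⟩
    have : ρ y (ρ x v) = v := by
      rw [← End.mul_apply, ← map_mul, mul_eq_one_comm.mp h, map_one, End.one_apply]
    simp [this, neg_add_eq_sub]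
  exact le_antisymm (key _ _ hs) (key _ _ hs')

theorem add_add_eq_zero_of_mem_moved (h : [a, b, c].Nodup) {v : V} (hv : v ∈ moved ρ a b c) :
    v + ρ (cyc a b c) v + ρ (cyc a b c) (ρ (cyc a b c) v) = 0 := by
  simp only [List.nodup_cons, List.mem_cons] at h
  obtain ⟨w, rfl⟩ := hv
  have h3 : (ρ (cyc a b c) ^ 3) w = w := by
    rw [← map_pow, cyc_pow_three (by grind) (by grind) (by grind), map_one, End.one_apply]
  simp only [pow_succ, pow_zero, one_mul, End.mul_apply] at h3
  simp only [LinearMap.sub_apply, End.one_apply, map_sub, h3]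
  abel

theorem eq_zero_of_mem_moved (h3 : (3 : F) ≠ 0) (h : [a, b, c].Nodup) {v : V}
    (hv : v ∈ moved ρ a b c) (hfix : ρ (cyc a b c) v = v) : v = 0 := by
  have := add_add_eq_zero_of_mem_moved ρ h hv
  rw [hfix, hfix] at this
  refine (smul_eq_zero.mp (show (3 : F) • v = 0 from ?_)).resolve_left h3
  rw [← this]; module

theorem finrank_moved_eq (h5 : 5 ≤ Fintype.card α) {a' b' c' : α} (h : [a, b, c].Nodup)
    (h' : [a', b', c'].Nodup) : finrank F (moved ρ a b c) = finrank F (moved ρ a' b' c') := by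
  simp only [List.nodup_cons, List.mem_cons] at h h'
  obtain ⟨g, hg⟩ := isConj_iff.mp (alternatingGroup.isThreeCycle_isConj
    (σ := cyc a b c) (τ := cyc a' b' c') (by simpa using h5)
    (isThreeCycle_cyc (by grind) (by grind) (by grind))
    (isThreeCycle_cyc (by grind) (by grind) (by grind)))
  rw [(Submodule.equivMapOfInjective _ (rep_injective ρ g) (moved ρ a b c)).finrank_eq, map_moved,
    moved, moved, ← alternating_conj_cyc, hg]

end Moved

section Rank

theorem finrank_moved_le_two {F V : Type*} [Field F] [AddCommGroup V] [Module F V]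
    [FiniteDimensional F V] {n : ℕ} (h3 : (3 : F) ≠ 0) (h10 : 10 ≤ n) (hd : finrank F V < n - 2)
    (ρ : alternatingGroup (Fin n) →* End F V)
    (hρ : ∀ (e : Fin (n / 3) × Fin 3 ↪ Fin n) (i j : Fin (n / 3)), i ≠ j →
      (ρ (blockCycle e i) - 1) * (ρ (blockCycle e j) - 1) = 0)
    {a b c : Fin n} (h : [a, b, c].Nodup) : finrank F (moved ρ a b c) ≤ 2 := by
  let e : Fin (n / 3) × Fin 3 ↪ Fin n :=
    ⟨fun p ↦ ⟨3 * p.1 + p.2, by have := p.1.2; have := p.2.2; omega⟩, fun p q hpq ↦ by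
      simp only [Fin.mk.injEq] at hpq
      ext <;> omega⟩
  let W : Fin (n / 3) → Submodule F V := fun i ↦ moved ρ (e (i, 0)) (e (i, 1)) (e (i, 2))
  have hnd : ∀ i, [e (i, 0), e (i, 1), e (i, 2)].Nodup := fun i ↦ by simp
  have hW : ∀ i, finrank F (W i) = finrank F (moved ρ a b c) := fun i ↦
    finrank_moved_eq ρ (by simp; omega) (hnd i) h
  have hs : ∀ s : Finset (Fin (n / 3)),
      s.card * finrank F (moved ρ a b c) ≤ finrank F (s.sup W : Submodule F V) := by
    intro s
    induction s using Finset.induction_on with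
    | empty => simp
    | insert i s hi ih =>
      have hker : s.sup W ≤ LinearMap.ker (ρ (blockCycle e i) - 1) :=
        Finset.sup_le fun j hj ↦ by
          rintro _ ⟨v, rfl⟩
          exact DFunLike.congr_fun (hρ e i j fun hij ↦ hi (hij ▸ hj)) v
      have hdis : W i ⊓ s.sup W = ⊥ := (Submodule.eq_bot_iff _).mpr fun v ⟨hv, hv'⟩ ↦
        eq_zero_of_mem_moved ρ h3 (hnd i) hv (sub_eq_zero.mp (hker hv'))
      have := Submodule.finrank_sup_add_finrank_inf_eq (W i) (s.sup W)
      rw [hdis, finrank_bot, hW] at this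
      rw [Finset.sup_insert, Finset.card_insert_of_notMem hi, add_mul]
      omega
  by_contra! hr
  have h1 := (hs Finset.univ).trans (Submodule.finrank_le _)
  rw [Finset.card_univ, Fintype.card_fin] at h1
  have h2 := Nat.mul_le_mul_left (n / 3) hr
  omega

end Rank

section Edges

theorem exists_notMem_of_length_lt {n : ℕ} (l : List (Fin n)) (h : l.length < n) :
    ∃ x, x ∉ l := by
  by_contra! hc
  have h1 := Finset.card_le_card (show Finset.univ ⊆ l.toFinset from fun x _ ↦ by simpa using hc x)
  have h2 := l.toFinset_card_le
  simp at h1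
  omega

variable {V : Type*} [AddCommGroup V] [Module (ZMod 2) V] {n : ℕ}
  {ρ : alternatingGroup (Fin n) →* End (ZMod 2) V} {a b c d : Fin n}

theorem moved_ne_moved (h10 : 10 ≤ n)
    (hfix : ∀ a b c d e f : Fin n, [a, b, c, d, e, f].Nodup → ∀ v ∈ moved ρ a b c,
      ρ (cyc d e f) v = v)
    (hne : ∀ a b c : Fin n, [a, b, c].Nodup → moved ρ a b c ≠ ⊥)
    (h : [a, b, c, d].Nodup) : moved ρ a b c ≠ moved ρ a b d := by
  intro heq
  obtain ⟨x, hx⟩ := exists_notMem_of_length_lt [a, b, c, d] (by simp; omega)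
  obtain ⟨y, hy⟩ := exists_notMem_of_length_lt [a, b, c, d, x] (by simp; omega)
  simp only [List.nodup_cons, List.mem_cons] at h hx hy
  have hW : ∀ x y, x ∉ [a, b, c, d] → y ∉ [a, b, c, d, x] → moved ρ a b x = moved ρ a b c := by
    intro x y hx hy
    simp only [List.mem_cons] at hx hy
    have h1 := map_moved ρ (cyc d x y) a b c
    have h2 := map_moved ρ (cyc d x y) a b d
    simp only [cyc_apply (show d ≠ x by grind) (show d ≠ y by grind) (show x ≠ y by grind)] at h1 h2
    rw [← heq] at h2
    grind
  have hWx := hW x y (by grind) (by grind)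
  have hWy := hW y x (by grind) (by grind)
  have h1 := map_moved ρ (cyc a b x) a b x
  have h2 := map_moved ρ (cyc a b x) a b c
  have h3 := map_moved ρ (cyc a b y) a b y
  have h4 := map_moved ρ (cyc a b y) b x c
  simp only [cyc_apply (show a ≠ b by grind) (show a ≠ x by grind) (show b ≠ x by grind),
    cyc_apply (show a ≠ b by grind) (show a ≠ y by grind) (show b ≠ y by grind)] at h1 h2 h3 h4
  have h5 := moved_rotate ρ (a := a) (b := b) (c := x) (by simp; grind)
  have h6 := moved_rotate ρ (a := a) (b := b) (c := y) (by simp; grind)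
  have h7 : moved ρ y x c = moved ρ a b d := by grind
  refine hne y x c (by simp; grind) ((Submodule.eq_bot_iff _).mpr fun v hv ↦ ?_)
  exact eq_zero_of_mem_moved ρ (by decide) (by simp; grind) hv
    (hfix a b d y x c (by simp; grind) v (h7 ▸ hv))

theorem exists_ne_zero_mem_moved [FiniteDimensional (ZMod 2) V] (h10 : 10 ≤ n)
    (hfix : ∀ a b c d e f : Fin n, [a, b, c, d, e, f].Nodup → ∀ v ∈ moved ρ a b c,
      ρ (cyc d e f) v = v)
    (hne : ∀ a b c : Fin n, [a, b, c].Nodup → moved ρ a b c ≠ ⊥)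
    (h : [a, b, c, d].Nodup) : ∃ v ≠ 0, v ∈ moved ρ a b c ∧ v ∈ moved ρ a b d := by
  by_contra! hc
  obtain ⟨e, he⟩ := exists_notMem_of_length_lt [a, b, c, d] (by simp; omega)
  obtain ⟨f, hf⟩ := exists_notMem_of_length_lt [a, b, c, d, e] (by simp; omega)
  obtain ⟨g, hg⟩ := exists_notMem_of_length_lt [a, b, c, d, e, f] (by simp; omega)
  simp only [List.nodup_cons, List.mem_cons] at h he hf hg
  have hdis : moved ρ a b c ⊓ moved ρ a b d = ⊥ := (Submodule.eq_bot_iff _).mpr fun v ⟨hv, hv'⟩ ↦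
    by_contra fun h0 ↦ hc v h0 hv hv'
  have hle : moved ρ a b c ⊔ moved ρ a b d ≤ moved ρ a b c ⊔ moved ρ c d e := by
    refine sup_le le_sup_left fun v hv ↦ ?_
    have h1 : (moved ρ a b c).map (ρ (cyc c d e)) = moved ρ a b d := by
      simp only [map_moved,
        cyc_apply (show c ≠ d by grind) (show c ≠ e by grind) (show d ≠ e by grind)]
      grind
    obtain ⟨u, hu, rfl⟩ := h1 ▸ hv
    rw [← add_sub_cancel u (ρ (cyc c d e) u)]
    exact Submodule.add_mem_sup hu (sub_mem_moved ρ u)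
  have h1 := Submodule.finrank_sup_add_finrank_inf_eq (moved ρ a b c) (moved ρ a b d)
  have h2 := Submodule.finrank_add_le_finrank_add_finrank (moved ρ a b c) (moved ρ c d e)
  rw [hdis, finrank_bot, add_zero, finrank_moved_eq ρ (by simp; omega)
    (show [a, b, d].Nodup by simp; grind) (show [a, b, c].Nodup by simp; grind)] at h1
  rw [finrank_moved_eq ρ (by simp; omega)
    (show [c, d, e].Nodup by simp; grind) (show [a, b, c].Nodup by simp; grind), ← h1] at h2
  have heq := Submodule.eq_of_le_of_finrank_le hle h2
  have hfixed : ∀ v ∈ moved ρ c d e, ρ (cyc e f g) v = v := by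
    intro v hv
    have hv' : v ∈ moved ρ a b c ⊔ moved ρ a b d := heq ▸ Submodule.mem_sup_right hv
    obtain ⟨x, hx, y, hy, rfl⟩ := Submodule.mem_sup.mp hv'
    rw [map_add, hfix a b c e f g (by simp; grind) x hx, hfix a b d e f g (by simp; grind) y hy]
  refine moved_ne_moved h10 hfix hne (show [c, d, e, f].Nodup by simp; grind) ?_
  have h3 : (moved ρ c d e).map (ρ (cyc e f g)) = moved ρ c d f := by
    simp only [map_moved,
      cyc_apply (show e ≠ f by grind) (show e ≠ g by grind) (show f ≠ g by grind)]
    grind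
  rw [← h3]
  ext v
  constructor
  · exact fun hv ↦ ⟨v, hv, hfixed v hv⟩
  · rintro ⟨u, hu, rfl⟩
    rwa [hfixed u hu]

theorem mem_moved_of_mem_of_mem (h10 : 10 ≤ n)
    (hfix : ∀ a b c d e f : Fin n, [a, b, c, d, e, f].Nodup → ∀ v ∈ moved ρ a b c,
      ρ (cyc d e f) v = v)
    (h : [a, b, c, d].Nodup) {v : V} (hc : v ∈ moved ρ a b c) (hd : v ∈ moved ρ a b d)
    {x : Fin n} (hxa : x ≠ a) (hxb : x ≠ b) : v ∈ moved ρ a b x := by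
  by_cases hxc : x = c
  · rwa [hxc]
  by_cases hxd : x = d
  · rwa [hxd]
  obtain ⟨y, hy⟩ := exists_notMem_of_length_lt [a, b, c, d, x] (by simp; omega)
  simp only [List.nodup_cons, List.mem_cons] at h hy
  have h1 := apply_mem_moved ρ hd (cyc d x y)
  rw [hfix a b c d x y (by simp; grind) v hc] at h1
  simp only [cyc_apply (show d ≠ x by grind) (show d ≠ y by grind) (show x ≠ y by grind)] at h1
  grind

theorem eq_of_mem_moved [FiniteDimensional (ZMod 2) V] (h10 : 10 ≤ n)
    (hfix : ∀ a b c d e f : Fin n, [a, b, c, d, e, f].Nodup → ∀ v ∈ moved ρ a b c,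
      ρ (cyc d e f) v = v)
    (hne : ∀ a b c : Fin n, [a, b, c].Nodup → moved ρ a b c ≠ ⊥)
    (h2 : ∀ a b c : Fin n, [a, b, c].Nodup → finrank (ZMod 2) (moved ρ a b c) ≤ 2)
    (h : [a, b, c, d].Nodup) {u v : V} (hu0 : u ≠ 0) (hv0 : v ≠ 0)
    (huc : u ∈ moved ρ a b c) (hud : u ∈ moved ρ a b d)
    (hvc : v ∈ moved ρ a b c) (hvd : v ∈ moved ρ a b d) : u = v := by
  have hmm := moved_ne_moved h10 hfix hne h
  simp only [List.nodup_cons, List.mem_cons] at h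
  have hlt : moved ρ a b c ⊓ moved ρ a b d < moved ρ a b c := by
    refine lt_of_le_of_ne inf_le_left fun heq ↦ hmm ?_
    exact Submodule.eq_of_le_of_finrank_eq (inf_eq_left.mp heq) (finrank_moved_eq ρ
      (by simp; omega) (by simp; grind) (by simp; grind))
  have h1 := (Submodule.finrank_lt_finrank_of_lt hlt).trans_le (h2 a b c (by simp; grind))
  obtain ⟨w, hw⟩ := finrank_le_one_iff.mp (Nat.lt_succ_iff.mp h1)
  have key : ∀ x : (moved ρ a b c ⊓ moved ρ a b d : Submodule (ZMod 2) V), (x : V) ≠ 0 → x = w := by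
    intro x hx
    obtain ⟨r, rfl⟩ := hw x
    have : r = 0 ∨ r = 1 := (by decide : ∀ r : ZMod 2, r = 0 ∨ r = 1) r
    rcases this with rfl | rfl <;> simp at hx ⊢
  exact congrArg Subtype.val
    ((key ⟨u, huc, hud⟩ hu0).trans (key ⟨v, hvc, hvd⟩ hv0).symm)

end Edges

section StandardModule

theorem sub_two_le_finrank {V : Type*} [AddCommGroup V] [Module (ZMod 2) V]
    [FiniteDimensional (ZMod 2) V] {n : ℕ} (h10 : 10 ≤ n)
    (ρ : alternatingGroup (Fin n) →* End (ZMod 2) V)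
    (hfix : ∀ a b c d e f : Fin n, [a, b, c, d, e, f].Nodup → ∀ v ∈ moved ρ a b c,
      ρ (cyc d e f) v = v)
    (hne : ∀ a b c : Fin n, [a, b, c].Nodup → moved ρ a b c ≠ ⊥)
    (h2 : ∀ a b c : Fin n, [a, b, c].Nodup → finrank (ZMod 2) (moved ρ a b c) ≤ 2) :
    n - 2 ≤ finrank (ZMod 2) V := by
  have hE : ∀ a b : Fin n, ∃ v : V, a ≠ b → v ≠ 0 ∧ ∀ x, x ≠ a → x ≠ b → v ∈ moved ρ a b x := by
    intro a b
    by_cases hab : a = b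
    · exact ⟨0, fun h ↦ (h hab).elim⟩
    obtain ⟨c, hc⟩ := exists_notMem_of_length_lt [a, b] (by simp; omega)
    obtain ⟨d, hd⟩ := exists_notMem_of_length_lt [a, b, c] (by simp; omega)
    have hnd : [a, b, c, d].Nodup := by simp at hc hd ⊢; grind
    obtain ⟨v, hv0, hvc, hvd⟩ := exists_ne_zero_mem_moved h10 hfix hne hnd
    exact ⟨v, fun _ ↦ ⟨hv0, fun x hxa hxb ↦ mem_moved_of_mem_of_mem h10 hfix hnd hvc hvd hxa hxb⟩⟩
  choose E hE using hE
  have huniq : ∀ a b, a ≠ b → ∀ v ≠ 0, (∀ x, x ≠ a → x ≠ b → v ∈ moved ρ a b x) → v = E a b := by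
    intro a b hab v hv0 hv
    obtain ⟨c, hc⟩ := exists_notMem_of_length_lt [a, b] (by simp; omega)
    obtain ⟨d, hd⟩ := exists_notMem_of_length_lt [a, b, c] (by simp; omega)
    have hnd : [a, b, c, d].Nodup := by simp at hc hd ⊢; grind
    simp only [List.mem_cons] at hc hd
    have hEab := hE a b hab
    exact eq_of_mem_moved h10 hfix hne h2 hnd hv0 hEab.1 (hv c (by grind) (by grind))
      (hv d (by grind) (by grind)) (hEab.2 c (by grind) (by grind)) (hEab.2 d (by grind) (by grind))
  have hequiv : ∀ (g : alternatingGroup (Fin n)) (a b), a ≠ b → ρ g (E a b) = E (g.1 a) (g.1 b) := by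
    intro g a b hab
    refine huniq _ _ (g.1.injective.ne hab) _
      ((map_ne_zero_iff _ (rep_injective ρ g)).mpr (hE a b hab).1) fun x hxa hxb ↦ ?_
    have := apply_mem_moved ρ ((hE a b hab).2 (g.1⁻¹ x) (by rintro rfl; simp at hxa)
      (by rintro rfl; simp at hxb)) g
    simpa using this
  have hsymm : ∀ a b, a ≠ b → E a b = E b a := fun a b hab ↦
    huniq b a hab.symm _ (hE a b hab).1 fun x hxb hxa ↦ by
      rw [moved_flip ρ (by simp; grind)]
      exact (hE a b hab).2 x hxa hxb
  have hsum : ∀ a b c : Fin n, a ≠ b → a ≠ c → b ≠ c → E a b + E b c + E c a = 0 := by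
    intro a b c hab hac hbc
    have := add_add_eq_zero_of_mem_moved ρ (show [a, b, c].Nodup by simp; grind)
      ((hE a b hab).2 c hac.symm hbc.symm)
    simpa [hequiv _ a b hab, hequiv _ b c hbc, cyc_apply hab hac hbc, hab.symm, hac.symm, hbc.symm]
      using this
  have hEne : ∀ o z x : Fin n, o ≠ z → o ≠ x → z ≠ x → E o z ≠ E o x := by
    intro o z x hoz hox hzx h
    have h1 := hsum o z x hoz hox hzx
    rw [← hsymm o x hox, ← h, add_right_comm, ZModModule.add_self, zero_add] at h1
    exact (hE z x hzx).1 h1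
  let o : Fin n := ⟨0, by omega⟩
  let z : Fin n := ⟨1, by omega⟩
  have hoz : o ≠ z := by simp [o, z]
  have hlin : LinearIndepOn (ZMod 2) (E o) (({o, z} : Finset (Fin n))ᶜ : Finset (Fin n)) := by
    refine linearIndepOn_finset_iff.mpr fun c hc j hj ↦ by_contra fun hcj ↦ ?_
    obtain ⟨k, hk⟩ := exists_notMem_of_length_lt [o, z, j] (by simp; omega)
    simp only [List.mem_cons] at hk
    simp only [Finset.mem_compl, Finset.mem_insert, Finset.mem_singleton] at hj
    have hσ := cyc_apply (show j ≠ z by grind) (show j ≠ k by grind) (show z ≠ k by grind)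
    have h0 : ∑ i ∈ ({o, z} : Finset (Fin n))ᶜ, c i • (ρ (cyc j z k) (E o i) - E o i) = 0 := by
      simp_rw [smul_sub, Finset.sum_sub_distrib, hc, ← map_smul, ← map_sum, hc, map_zero, sub_zero]
    have hEσ : ∀ i, o ≠ i → ρ (cyc j z k) (E o i) = E o ((cyc j z k).1 i) := fun i hi ↦ by
      rw [hequiv _ _ _ hi, hσ o]
      grind
    rw [Finset.sum_eq_add_of_mem j k (by simp; grind) (by simp; grind) (by grind),
      hEσ j (by grind), hEσ k (by grind), hσ, hσ, if_pos rfl, if_neg (by grind), if_neg (by grind),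
      if_pos rfl] at h0
    · have h01 : ∀ r : ZMod 2, r = 0 ∨ r = 1 := by decide
      rw [(h01 (c j)).resolve_left hcj, one_smul] at h0
      rcases h01 (c k) with hck | hck
      · rw [hck, zero_smul, add_zero, sub_eq_zero] at h0
        exact hEne o z j hoz (by grind) (by grind) h0
      · rw [hck, one_smul, sub_add_sub_cancel, sub_eq_zero] at h0
        exact hEne o z k hoz (by grind) (by grind) h0
    · intro i hi hij
      simp only [Finset.mem_compl, Finset.mem_insert, Finset.mem_singleton] at hi
      rw [hEσ i (by grind), hσ, if_neg (by grind), if_neg (by grind), if_neg (by grind), sub_self,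
        smul_zero]
  have := LinearIndependent.fintype_card_le_finrank hlin
  simp only [Finset.coe_sort_coe, Fintype.card_coe] at this
  rwa [Finset.card_compl, Fintype.card_fin, Finset.card_pair hoz] at this

end StandardModule

/-- Let `n ≥ 10` be an even integer and `d` a positive integer with `d < n - 2`.
Every group homomorphism from the alternating group `A_n` to `GL_d(𝔽₂)` is trivial. -/
theorem stmt_3 (n d : ℕ) (hn : Even n) (h10 : 10 ≤ n)
    (hd : 0 < d) (hdn : d < n - 2)
    (f : alternatingGroup (Fin n) →* Matrix.GeneralLinearGroup (Fin d) (ZMod 2)) :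
    f = 1 := by
  by_contra hf
  have h0 := fun (e : Fin (n / 3) × Fin 3 ↪ Fin n) i j ↦
    matrixRep_self_sub_one_mul_sub_one hn h10 hdn f e (i := i) (j := j)
  have h := sub_two_le_finrank h10 (matrixRep (ZMod 2) f) ?_ ?_ ?_
  · rw [finrank_fin_fun] at h
    omega
  · rintro a b c d e f hnd _ ⟨v, rfl⟩
    obtain ⟨ε, i, j, hij, hi, hj⟩ := exists_blocks (by omega) hnd
    have := h0 ε j i hij.symm
    rw [hi, hj] at this
    exact sub_eq_zero.mp (DFunLike.congr_fun this v)
  · intro a b c hnd hbot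
    simp only [List.nodup_cons, List.mem_cons] at hnd
    have h3 : cyc a b c ≠ 1 := fun h ↦ by
      have := cyc_apply (a := a) (b := b) (c := c) (by grind) (by grind) (by grind) a
      rw [h, Subgroup.coe_one, Perm.one_apply, if_pos rfl] at this
      grind
    have h1 : f (cyc a b c) = 1 := by
      rw [moved, LinearMap.range_eq_bot, sub_eq_zero, matrixRep_apply, map_eq_one_iff _
        Matrix.toLinAlgEquiv'.injective] at hbot
      exact Units.ext (by simpa using hbot)
    have := alternatingGroup.isSimpleGroup (α := Fin n) (by simp; omega)
    rcases f.normal_ker.eq_bot_or_eq_top with hker | hker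
    · exact h3 ((Subgroup.eq_bot_iff_forall _).mp hker _ h1)
    · exact hf (MonoidHom.ker_eq_top_iff.mp hker)
  · intro a b c hnd
    exact finrank_moved_le_two (by decide) h10 (by simpa using hdn) _ h0 hnd
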